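/- Let N ≥ 1, s ≥ 1, n ≥ 1, π ∈ S_n, t : {1,…,n} → {1,…,s}, and h : {1,…,n} → M_{N×N}(ℂ), writing h_i = h(i). Then for any N×N complex matrices x_1, …, x_s, q_{π,t,h}(x_1,…,x_s) = Σ_{J : {1,…,n} → {1,…,N}} ∏_{i=1}^n [ h_i x_{t(i)} ]_{J(i), J(π(i))}, where [A]_{i,j} denotes the (i,j)-th entry of a matrix A. -/

import Mathlib

open MeasureTheory ProbabilityTheory Matrix Filter
open scoped ComplexOrder

noncomputable section

/-- The measurable space structure on complex matrices (entrywise/product σ-algebra). -/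
instance matMS (N : ℕ) : MeasurableSpace (Matrix (Fin N) (Fin N) ℂ) :=
  inferInstanceAs (MeasurableSpace (Fin N → Fin N → ℂ))

/-- The set of minimal representatives of the cycles of a permutation. -/
def cycleReps {β : Type*} [Fintype β] [LinearOrder β] (π : Equiv.Perm β) : Finset β :=
  Finset.univ.filter fun j => ∀ i ∈ Finset.range (Fintype.card β), j ≤ (π ^ i) j

/-- The number of cycles of a permutation (fixed points count as cycles of length one). -/
def cycleCount {β : Type*} [Fintype β] [LinearOrder β] (π : Equiv.Perm β) : ℕ :=
  (cycleReps π).card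

/-- The product `f j * f (π j) * f (π² j) * ⋯` along the cycle of `π` containing `j`. -/
def cycleProd {β M : Type*} [Monoid M] (π : Equiv.Perm β) (f : β → M) (j : β) : M :=
  ((List.range (Function.minimalPeriod ⇑π j)).map fun i => f ((π ^ i) j)).prod

/-- `q_{σ,t,h}(x₁,…,x_s) = ∏_{c ∈ C(σ)} tr (∏_{j ∈ c} h(j) x_{t(j)})`, the product inside each
trace being taken in the order in which the elements appear along the cycle. -/
def qMonomial {n N s : ℕ} (σ : Equiv.Perm (Fin n)) (t : Fin n → Fin s)
    (h : Fin n → Matrix (Fin N) (Fin N) ℂ) (x : Fin s → Matrix (Fin N) (Fin N) ℂ) : ℂ :=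
  ∏ j ∈ cycleReps σ, (cycleProd σ (fun i => h i * x (t i)) j).trace

/-- `p ∈ {1,…,N} ∪ (N,∞)`. -/
def ShapeParam (N : ℕ) (p : ℝ) : Prop :=
  (∃ k : ℕ, 1 ≤ k ∧ k ≤ N ∧ p = k) ∨ (N : ℝ) < p

/-- `W` has the complex Wishart law with scale `S` and shape `p`: it is Hermitian valued and its
Laplace transform is `det(I - θ S)^{-p}` for all Hermitian `θ` with `S⁻¹ - θ` positive definite. -/
def IsWishart {N : ℕ} {Ω : Type*} [MeasurableSpace Ω] (μ : Measure Ω)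
    (W : Ω → Matrix (Fin N) (Fin N) ℂ) (S : Matrix (Fin N) (Fin N) ℂ) (p : ℝ) : Prop :=
  (∀ ω, (W ω).IsHermitian) ∧
    ∀ θ : Matrix (Fin N) (Fin N) ℂ, θ.IsHermitian → (S⁻¹ - θ).PosDef →
      ∫ ω, Complex.exp ((θ * W ω).trace) ∂μ = (1 - θ * S).det ^ (-(p : ℂ))


/-- An entry of a nonempty product of square matrices is a sum over paths. -/
theorem Matrix.list_ofFn_prod_apply {ι R : Type*} [Fintype ι] [DecidableEq ι] [CommSemiring R]
    {m : ℕ} (A : Fin (m + 1) → Matrix ι ι R) (a b : ι) :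
    (List.ofFn A).prod a b = ∑ K : Fin m → ι, ∏ i,
      A i (Fin.cons (α := fun _ => ι) a K i) (Fin.snoc (α := fun _ => ι) K b i) := by
  induction m generalizing a with
  | zero => simp [Fin.snoc]
  | succ m ih =>
    rw [List.ofFn_succ, List.prod_cons, Matrix.mul_apply,
      ← (Fin.consEquiv fun _ : Fin (m + 1) => ι).sum_comp, Fintype.sum_prod_type]
    refine Finset.sum_congr rfl fun c _ => ?_
    rw [ih, Finset.mul_sum]
    refine Finset.sum_congr rfl fun K _ => ?_
    rw [Fin.prod_univ_succ (n := m + 1)]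
    have hK : (Fin.snoc (α := fun _ => ι) ((Fin.consEquiv fun _ => ι) (c, K)) b :
        Fin (m + 1 + 1) → ι) = Fin.cons (α := fun _ => ι) c (Fin.snoc (α := fun _ => ι) K b) :=
      (Fin.cons_snoc_eq_snoc_cons c K b).symm
    simp only [hK, Fin.consEquiv_apply, Fin.cons_zero, Fin.cons_succ]

/-- The trace of a nonempty product of square matrices is a sum over closed paths. -/
theorem Matrix.trace_list_ofFn_prod {ι R : Type*} [Fintype ι] [DecidableEq ι] [CommSemiring R]
    {m : ℕ} (hm : 0 < m) (A : Fin m → Matrix ι ι R) :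
    (List.ofFn A).prod.trace = ∑ K : Fin m → ι, ∏ i, A i (K i) (K (finRotate m i)) := by
  obtain ⟨m, rfl⟩ := Nat.exists_eq_succ_of_ne_zero hm.ne'
  rw [← (Fin.consEquiv fun _ : Fin (m + 1) => ι).sum_comp, Fintype.sum_prod_type]
  refine Finset.sum_congr rfl fun a _ => ?_
  simp only [Matrix.diag_apply, Matrix.list_ofFn_prod_apply, Fin.snoc_eq_cons_rotate,
    Fin.consEquiv_apply]

section Cycles

variable {β : Type*}

theorem Equiv.Perm.minimalPeriod_pos [Finite β] (π : Equiv.Perm β) (j : β) :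
    0 < Function.minimalPeriod π j :=
  Function.minimalPeriod_pos_of_mem_periodicPts (π.injective.mem_periodicPts j)

theorem Equiv.Perm.pow_mod_minimalPeriod_apply (π : Equiv.Perm β) (j : β) (i : ℕ) :
    (π ^ (i % Function.minimalPeriod π j)) j = (π ^ i) j := by
  simpa only [Equiv.Perm.iterate_eq_pow] using
    Function.iterate_mod_minimalPeriod_eq (f := π) (x := j) (n := i)

theorem Equiv.Perm.SameCycle.exists_lt_minimalPeriod [Finite β] {π : Equiv.Perm β} {j k : β}
    (h : π.SameCycle j k) : ∃ i < Function.minimalPeriod π j, (π ^ i) j = k := by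
  obtain ⟨i, hi⟩ := h.exists_nat_pow_eq
  exact ⟨i % Function.minimalPeriod π j, Nat.mod_lt _ (π.minimalPeriod_pos j),
    (π.pow_mod_minimalPeriod_apply j i).trans hi⟩

theorem Equiv.Perm.pow_finRotate_apply (π : Equiv.Perm β) (j : β)
    (i : Fin (Function.minimalPeriod π j)) :
    (π ^ (finRotate _ i : ℕ)) j = π ((π ^ (i : ℕ)) j) := by
  have := i.neZero
  rw [finRotate_apply, Fin.val_add, ← Equiv.Perm.mul_apply, ← pow_succ',
    ← π.pow_mod_minimalPeriod_apply j (i + 1)]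
  simp only [Fin.val_one', Nat.add_mod_mod]

theorem mem_cycleReps_iff [Fintype β] [LinearOrder β] {π : Equiv.Perm β} {j : β} :
    j ∈ cycleReps π ↔ ∀ k, π.SameCycle j k → j ≤ k := by
  simp only [cycleReps, Finset.mem_filter, Finset.mem_univ, true_and, Finset.mem_range]
  refine ⟨fun h k hk => ?_, fun h i _ => h _ ⟨i, rfl⟩⟩
  obtain ⟨i, hi, rfl⟩ := hk.exists_lt_minimalPeriod
  exact h i (hi.trans_le Function.minimalPeriod_le_card)

/-- Every point is reached exactly once by running along the cycles from their representatives. -/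
theorem bijective_pow_cycleReps [Fintype β] [LinearOrder β] (π : Equiv.Perm β) :
    Function.Bijective fun p : Σ j : cycleReps π, Fin (Function.minimalPeriod π (j : β)) =>
      (π ^ (p.2 : ℕ)) (p.1 : β) := by
  constructor
  · rintro ⟨⟨j, hj⟩, i⟩ ⟨⟨k, hk⟩, l⟩ h
    have hjk : π.SameCycle j k := by
      have hj' : π.SameCycle j ((π ^ (i : ℕ)) j) := ⟨i, rfl⟩
      have hk' : π.SameCycle k ((π ^ (i : ℕ)) j) := ⟨l, h.symm⟩
      exact hj'.trans hk'.symm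
    obtain rfl : j = k :=
      le_antisymm (mem_cycleReps_iff.1 hj _ hjk) (mem_cycleReps_iff.1 hk _ hjk.symm)
    have hil : i = l := Fin.ext <| Function.iterate_injOn_Iio_minimalPeriod i.2 l.2 <| by
      simpa only [Equiv.Perm.iterate_eq_pow] using h
    rw [hil]
  · intro k
    classical
    have hne : (Finset.univ.filter (π.SameCycle k)).Nonempty :=
      ⟨k, by simp [Equiv.Perm.SameCycle.refl]⟩
    obtain ⟨j, hj, hmin⟩ := Finset.exists_min_image _ id hne
    simp only [Finset.mem_filter, Finset.mem_univ, true_and, id] at hj hmin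
    obtain ⟨i, hi, hik⟩ := hj.symm.exists_lt_minimalPeriod
    exact ⟨⟨⟨j, mem_cycleReps_iff.2 fun l hl => hmin l (hj.trans hl)⟩, ⟨i, hi⟩⟩, hik⟩

/-- The product over the cycles of the traces of the cycle products, expanded entrywise. -/
theorem prod_trace_cycleProd [Fintype β] [LinearOrder β] {ι R : Type*} [Fintype ι] [DecidableEq ι]
    [CommSemiring R] (π : Equiv.Perm β) (A : β → Matrix ι ι R) :
    ∏ j ∈ cycleReps π, (cycleProd π A j).trace = ∑ J : β → ι, ∏ i, A i (J i) (J (π i)) := by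
  classical
  have hcycle (j : β) : (cycleProd π A j).trace =
      ∑ K : Fin (Function.minimalPeriod π j) → ι,
        ∏ i : Fin (Function.minimalPeriod π j), A ((π ^ (i : ℕ)) j) (K i) (K (finRotate _ i)) := by
    rw [← Matrix.trace_list_ofFn_prod (π.minimalPeriod_pos j)
      fun i => A ((π ^ (i : ℕ)) j), cycleProd, List.ofFn_eq_map, ← List.map_coe_finRange_eq_range,
      List.map_map]
    rfl
  let e := Equiv.ofBijective _ (bijective_pow_cycleReps π)
  let E := (e.symm.arrowCongr (Equiv.refl ι)).trans (Equiv.piCurry fun _ _ => ι)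
  rw [← Finset.prod_coe_sort]
  simp only [hcycle]
  rw [Finset.prod_univ_sum, Fintype.piFinset_univ, ← E.sum_comp]
  refine Finset.sum_congr rfl fun J _ => ?_
  rw [← e.prod_comp, Fintype.prod_sigma]
  refine Finset.prod_congr rfl fun j _ => Finset.prod_congr rfl fun i _ => ?_
  change A _ (J _) (J ((π ^ (finRotate _ i : ℕ)) (j : β))) = _
  rw [π.pow_finRotate_apply]
  rfl

end Cycles

/-- Entrywise expansion of `q_{π,t,h}`:
`q_{π,t,h}(x₁,…,x_s) = ∑_{J : {1,…,n} → {1,…,N}} ∏_{i=1}^n [h_i x_{t(i)}]_{J(i), J(π(i))}`. -/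
theorem qMonomial_eq_sum_entries
    {N s n : ℕ} (hN : 1 ≤ N) (hs : 1 ≤ s) (hn : 1 ≤ n)
    (π : Equiv.Perm (Fin n)) (t : Fin n → Fin s) (h : Fin n → Matrix (Fin N) (Fin N) ℂ)
    (x : Fin s → Matrix (Fin N) (Fin N) ℂ) :
    qMonomial π t h x =
      ∑ J : Fin n → Fin N, ∏ i : Fin n, (h i * x (t i)) (J i) (J (π i)) :=
  prod_trace_cycleProd π fun i => h i * x (t i)

end
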